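/- For every square complex matrix M there exists a unitary matrix P such that M = P · M† · P, where M† denotes the conjugate transpose of M. -/

import Mathlib

open Matrix

theorem exists_unitary_conj_transpose (N : ℕ) (M : Matrix (Fin N) (Fin N) ℂ) :
    ∃ P : Matrix (Fin N) (Fin N) ℂ, Pᴴ * P = 1 ∧ M = P * Mᴴ * P := by
  have hH : (Mᴴ * M).IsHermitian := isHermitian_conjTranspose_mul_self M
  obtain ⟨U, d, hU, hU', hd⟩ : ∃ (U : Matrix (Fin N) (Fin N) ℂ) (d : Fin N → ℝ),
      Uᴴ * U = 1 ∧ U * Uᴴ = 1 ∧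
        (M * U)ᴴ * (M * U) = diagonal (fun i => (d i : ℂ)) := by
    refine ⟨hH.eigenvectorUnitary, hH.eigenvalues, ?_, ?_, ?_⟩
    · exact Unitary.coe_star_mul_self hH.eigenvectorUnitary
    · exact Unitary.coe_mul_star_self hH.eigenvectorUnitary
    · have h := hH.conjStarAlgAut_star_eigenvectorUnitary
      rw [Unitary.conjStarAlgAut_apply] at h
      simp only [conjTranspose_mul, Matrix.mul_assoc]
      simpa [star_eq_conjTranspose, Matrix.mul_assoc, Function.comp_def] using h
  set W := M * U with hW
  let w : Fin N → EuclideanSpace ℂ (Fin N) := fun i => WithLp.toLp 2 (fun k => W k i)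
  have hw : ∀ i j, inner ℂ (w i) (w j) = if i = j then (d i : ℂ) else 0 := by
    intro i j
    have := congrFun (congrFun hd i) j
    rw [diagonal_apply] at this
    rw [← this]
    simp [w, PiLp.inner_apply, Matrix.mul_apply, mul_comm]
  let v : Fin N → EuclideanSpace ℂ (Fin N) := fun i => ((‖w i‖ : ℂ)⁻¹) • w i
  have hv : Orthonormal ℂ (({i | w i ≠ 0} : Set (Fin N)).domRestrict v) := by
    constructor
    · rintro ⟨i, hi⟩
      have : ‖w i‖ ≠ 0 := norm_ne_zero_iff.mpr hi
      change ‖v i‖ = 1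
      simp [v, norm_smul, this]
    · rintro ⟨i, hi⟩ ⟨j, hj⟩ hij
      have : i ≠ j := fun h => hij (Subtype.ext h)
      change inner ℂ (v i) (v j) = 0
      simp [v, inner_smul_left, inner_smul_right, hw, this]
  obtain ⟨b, hb⟩ := hv.exists_orthonormalBasis_extension_of_card_eq (by simp)
  have hbw : ∀ i, w i = (‖w i‖ : ℂ) • b i := by
    intro i
    by_cases h : w i = 0
    · simp [h]
    · have h' : (‖w i‖ : ℂ) ≠ 0 := by exact_mod_cast norm_ne_zero_iff.mpr h
      rw [hb i h]
      simp only [v]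
      rw [smul_smul, mul_inv_cancel₀ h', one_smul]
  let V : Matrix (Fin N) (Fin N) ℂ := Matrix.of fun k i => b i k
  let S : Matrix (Fin N) (Fin N) ℂ := diagonal fun i => (‖w i‖ : ℂ)
  have hV : Vᴴ * V = 1 := by
    ext i j
    have := orthonormal_iff_ite.mp b.orthonormal i j
    rw [Matrix.one_apply, ← this]
    simp [V, PiLp.inner_apply, Matrix.mul_apply, mul_comm]
  have hS : Sᴴ = S := by
    simp only [S, diagonal_conjTranspose]
    congr 1
    ext i
    simp
  have hWV : W = V * S := by
    ext k i
    have := congrArg (fun x : EuclideanSpace ℂ (Fin N) => x k) (hbw i)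
    simp only [S, Matrix.mul_diagonal]
    simpa [w, V, mul_comm] using this
  have hM : M = V * S * Uᴴ := by
    rw [← hWV, hW, Matrix.mul_assoc, hU', Matrix.mul_one]
  refine ⟨V * Uᴴ, ?_, ?_⟩
  · rw [conjTranspose_mul, conjTranspose_conjTranspose, Matrix.mul_assoc,
      ← Matrix.mul_assoc Vᴴ, hV, Matrix.one_mul, hU']
  · have : V * Uᴴ * Mᴴ * (V * Uᴴ) = V * (Uᴴ * U) * S * (Vᴴ * V) * Uᴴ := by
      rw [hM]
      simp only [conjTranspose_mul, conjTranspose_conjTranspose, hS, Matrix.mul_assoc]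
    rw [this, hU, hV, Matrix.mul_one, Matrix.mul_one, hM]
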